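/- Let X, Y be Hilbert spaces and b : X × Y → ℝ a continuous bilinear form. Define B : X → Y' by ⟨Bv, λ⟩ = b(v, λ) and B^t : Y → X' by ⟨B^t λ, v⟩ = ⟨Bv, λ⟩. If b satisfies the inf-sup condition with constant α > 0, then the range of B^t equals the polar (annihilator) of Ker B, i.e., Im B^t = { l ∈ X' : ⟨l, v⟩ = 0 for all v ∈ Ker B }. -/

import Mathlib

theorem stmt1
    {X Y : Type*} [NormedAddCommGroup X] [InnerProductSpace ℝ X] [CompleteSpace X]
    [NormedAddCommGroup Y] [InnerProductSpace ℝ Y] [CompleteSpace Y]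
    (b : X → Y → ℝ)
    (hb_lin₁ : ∀ v, IsLinearMap ℝ (b v))
    (hb_lin₂ : ∀ μ, IsLinearMap ℝ (fun v => b v μ))
    (Mb : ℝ) (hb_cont : ∀ v μ, |b v μ| ≤ Mb * ‖v‖ * ‖μ‖)
    (B : X →L[ℝ] (Y →L[ℝ] ℝ)) (hB : ∀ v μ, B v μ = b v μ)
    (Bt : Y →L[ℝ] (X →L[ℝ] ℝ)) (hBt : ∀ μ v, Bt μ v = B v μ)
    (α : ℝ) (hα : 0 < α)
    (hinfsup : ∀ μ : Y, μ ≠ 0 →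
      α ≤ ⨆ v : {v : X // v ≠ 0}, b v μ / (‖(v : X)‖ * ‖μ‖)) :
    Set.range Bt = {l : X →L[ℝ] ℝ | ∀ v : X, B v = 0 → l v = 0} := by
  have hbound : ∀ μ : Y, α * ‖μ‖ ≤ ‖Bt μ‖ := by
    intro μ
    by_cases hμ : μ = 0
    · simp [hμ]
    have hpos : 0 < ‖μ‖ := norm_pos_iff.mpr hμ
    have h1 : (⨆ v : {v : X // v ≠ 0}, b v μ / (‖(v : X)‖ * ‖μ‖)) ≤ ‖Bt μ‖ / ‖μ‖ := by
      apply Real.iSup_le _ (by positivity)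
      rintro ⟨v, hv⟩
      have hvpos : 0 < ‖v‖ := norm_pos_iff.mpr hv
      rw [div_le_div_iff₀ (by positivity) hpos]
      have h2 : b v μ ≤ ‖Bt μ‖ * ‖v‖ := by
        rw [← hB, ← hBt]
        exact (le_abs_self _).trans ((Bt μ).le_opNorm v)
      calc b v μ * ‖μ‖ ≤ (‖Bt μ‖ * ‖v‖) * ‖μ‖ := by gcongr
        _ = _ := by ring
    exact (le_div_iff₀ hpos).mp ((hinfsup μ hμ).trans h1)
  have hclosed : IsClosed (Set.range Bt) := by
    have hanti : AntilipschitzWith (Real.toNNReal α⁻¹) Bt := by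
      apply AddMonoidHomClass.antilipschitz_of_bound
      intro μ
      rw [Real.coe_toNNReal _ (by positivity), inv_mul_eq_div, le_div_iff₀ hα, mul_comm]
      exact hbound μ
    exact hanti.isClosed_range Bt.uniformContinuous
  let K : Submodule ℝ X :=
    { carrier := {x | InnerProductSpace.toDual ℝ X x ∈ Set.range Bt}
      zero_mem' := ⟨0, by simp⟩
      add_mem' := by
        rintro x y ⟨p, hp⟩ ⟨q, hq⟩
        exact ⟨p + q, by rw [map_add, map_add, hp, hq]⟩
      smul_mem' := by
        rintro c x ⟨p, hp⟩
        exact ⟨c • p, by rw [map_smul, hp]; ext v; simp [inner_smul_left]⟩ }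
  have hK : IsClosed (K : Set X) :=
    hclosed.preimage (InnerProductSpace.toDual ℝ X).continuous
  ext l
  constructor
  · rintro ⟨μ, rfl⟩ v hv
    rw [hBt, hv]
    rfl
  · intro hl
    have hx : (InnerProductSpace.toDual ℝ X).symm l ∈ Kᗮᗮ := by
      rw [Submodule.mem_orthogonal']
      intro v hv
      rw [InnerProductSpace.toDual_symm_apply]
      apply hl
      ext μ
      rw [← hBt, ← InnerProductSpace.toDual_symm_apply]
      exact (Submodule.mem_orthogonal K v).mp hv _ ⟨μ, by simp⟩
    rw [Submodule.orthogonal_orthogonal_eq_closure, hK.submodule_topologicalClosure_eq] at hx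
    obtain ⟨μ, hμ⟩ := hx
    exact ⟨μ, by simpa using hμ⟩
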